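/- Let A be a finite left brace whose adjoint group A° is a nilpotent group. Then A is the direct sum of left braces whose cardinalities are powers of prime numbers. Moreover, if A has cardinality p₁^{α₁}⋯p_k^{α_k} for pairwise distinct primes p₁,…,p_k and positive integers α₁,…,α_k, then Aⁿ = 0 where n is the largest of the numbers α₁+1, α₂+1, …, α_k+1. -/

import Mathlib

namespace Paper

/-- A left brace: an abelian group `(A,+)` with a multiplication `bmul` that is left
distributive over addition and such that the circle operation
`a ∘ b = a·b + a + b` makes `A` into a group (the adjoint group) with identity `0`. -/
class LeftBrace (A : Type*) extends AddCommGroup A where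
  bmul : A → A → A
  bmul_add : ∀ a b c : A, bmul a (b + c) = bmul a b + bmul a c
  circ_assoc : ∀ a b c : A,
    bmul (bmul a b + a + b) c + (bmul a b + a + b) + c
      = bmul a (bmul b c + b + c) + a + (bmul b c + b + c)
  zero_circ : ∀ a : A, bmul 0 a + 0 + a = a
  circ_zero : ∀ a : A, bmul a 0 + a + 0 = a
  exists_circ_inv : ∀ a : A, ∃ b : A, bmul a b + a + b = 0 ∧ bmul b a + b + a = 0

namespace LeftBrace

variable {A : Type*} [LeftBrace A]

/-- The circle operation `a ∘ b = a·b + a + b` of a left brace. -/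
def circ (a b : A) : A := bmul a b + a + b

/-- The adjoint group `A°` of a left brace: the group `(A, ∘)`. -/
noncomputable def adjointGroup (A : Type*) [LeftBrace A] : Group A where
  mul := circ
  one := (0 : A)
  inv a := Classical.choose (exists_circ_inv a)
  mul_assoc := circ_assoc
  one_mul := zero_circ
  mul_one := circ_zero
  inv_mul_cancel a := (Classical.choose_spec (exists_circ_inv a)).2

/-- The adjoint group `A°` of the left brace `A` is a nilpotent group. -/
def AdjointNilpotent (A : Type*) [LeftBrace A] : Prop :=
  @Group.IsNilpotent A (adjointGroup A)

/-- For subsets `C, D ⊆ A`, `C · D` is the set of all finite sums `Σ cᵢ·dᵢ`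
with `cᵢ ∈ C`, `dᵢ ∈ D`, i.e. the additive submonoid generated by the products. -/
def setMulSub (C D : Set A) : AddSubmonoid A :=
  AddSubmonoid.closure {x : A | ∃ c ∈ C, ∃ d ∈ D, x = bmul c d}

/-- `C · D` as a set. -/
def setMul (C D : Set A) : Set A := (setMulSub C D : Set A)

/-- `pow A n = Aⁿ` for `n ≥ 1`: `A¹ = A`, `A^{n+1} = A · Aⁿ`.  (`pow A 0` is set to `A`.) -/
def pow (A : Type*) [LeftBrace A] : ℕ → Set A
  | 0 => Set.univ
  | 1 => Set.univ
  | (n+2) => setMul Set.univ (pow A (n+1))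

/-- `rpow A n = A^{(n)}` for `n ≥ 1`: `A^{(1)} = A`, `A^{(n+1)} = A^{(n)} · A`.
(`rpow A 0` is set to `A`.) -/
def rpow (A : Type*) [LeftBrace A] : ℕ → Set A
  | 0 => Set.univ
  | 1 => Set.univ
  | (n+2) => setMul (rpow A (n+1)) Set.univ

/-- `brk A n = A^{[n]}` for `n ≥ 1`: `A^{[1]} = A`,
`A^{[n+1]} = Σ_{i=1}^{n} A^{[i]} · A^{[n+1-i]}`.  (`brk A 0` is set to `A`.) -/
def brk (A : Type*) [LeftBrace A] : ℕ → Set A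
  | 0 => Set.univ
  | 1 => Set.univ
  | (n+2) =>
    (((Finset.range (n+1)).attach.sup
      (fun i => setMulSub (brk A (i.1 + 1)) (brk A (n + 1 - i.1)))) : AddSubmonoid A)
  decreasing_by
  · have h := i.2; simp only [Finset.mem_range] at h; omega
  · omega


/-- The product of a family of left braces, with componentwise operations. -/
noncomputable def piBrace {ι : Type*} (B : ι → Type*) (instB : ∀ i, LeftBrace (B i)) :
    LeftBrace (∀ i, B i) :=
  letI : ∀ i, LeftBrace (B i) := instB
  { (inferInstance : AddCommGroup (∀ i, B i)) with
    bmul := fun f g i => bmul (f i) (g i)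
    bmul_add := fun a b c => funext fun i => bmul_add (a i) (b i) (c i)
    circ_assoc := fun a b c => funext fun i => circ_assoc (a i) (b i) (c i)
    zero_circ := fun a => funext fun i => zero_circ (a i)
    circ_zero := fun a => funext fun i => circ_zero (a i)
    exists_circ_inv := fun a =>
      ⟨fun i => Classical.choose (exists_circ_inv (a i)),
        funext fun i => (Classical.choose_spec (exists_circ_inv (a i))).1,
        funext fun i => (Classical.choose_spec (exists_circ_inv (a i))).2⟩ }

/-- An isomorphism of left braces: an additive isomorphism preserving the brace
multiplication. -/
structure BraceIso (A B : Type*) [LeftBrace A] [LeftBrace B] extends A ≃+ B where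
  map_bmul : ∀ a b : A, toAddEquiv (bmul a b) = bmul (toAddEquiv a) (toAddEquiv b)

/-- `A` is the direct sum of (finitely many) left braces whose cardinalities are
powers of prime numbers. -/
def IsPrimePowerDirectSum (A : Type*) [LeftBrace A] : Prop :=
  ∃ (k : ℕ) (B : Fin k → Type) (instB : ∀ i, LeftBrace (B i)),
    (∀ i, ∃ p m : ℕ, p.Prime ∧ Nat.card (B i) = p ^ m) ∧
    Nonempty (@BraceIso A (∀ i, B i) _ (piBrace B instB))


theorem _root_.Group.IsNilpotent.commute_of_coprime_orderOf {G : Type*} [Group G] [Finite G]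
    (hG : Group.IsNilpotent G) {x y : G} (h : (orderOf x).Coprime (orderOf y)) : Commute x y := by
  obtain ⟨φ⟩ := ((Group.isNilpotent_of_finite_tfae (G := G)).out 0 4).mp hG
  suffices hc : Commute (φ.symm x) (φ.symm y) by simpa using hc.map φ
  have hdvd (z : G) (p) (P) : orderOf (φ.symm z p P) ∣ orderOf z :=
    orderOf_dvd_of_pow_eq_one <| by
      have hz : φ.symm z ^ orderOf z = 1 := by rw [← map_pow, pow_orderOf_eq_one, map_one]
      simpa using congrFun (congrFun hz p) P
  funext p P
  have : Fact (p : ℕ).Prime := ⟨Nat.prime_of_mem_primeFactors p.2⟩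
  obtain ⟨k, hk⟩ := P.2.exists_orderOf_eq_pow (φ.symm x p P)
  obtain ⟨l, hl⟩ := P.2.exists_orderOf_eq_pow (φ.symm y p P)
  have hco := (h.coprime_dvd_left (hdvd x p P)).coprime_dvd_right (hdvd y p P)
  rcases k.eq_zero_or_pos with rfl | hk0
  · have hx : φ.symm x p P = 1 := orderOf_eq_one_iff.mp (by simpa using hk)
    simp [hx]
  rcases l.eq_zero_or_pos with rfl | hl0
  · have hy : φ.symm y p P = 1 := orderOf_eq_one_iff.mp (by simpa using hl)
    simp [hy]
  · rw [hk, hl, Nat.coprime_pow_left_iff hk0, Nat.coprime_pow_right_iff hl0,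
      Nat.coprime_self] at hco
    exact absurd hco (Fact.out : (p : ℕ).Prime).ne_one

theorem bmul_zero (a : A) : bmul a 0 = 0 := by simpa using bmul_add a 0 0

theorem zero_bmul (a : A) : bmul 0 a = 0 := by simpa using zero_circ a

/-- Left multiplication by `a` as an additive endomorphism. -/
def bmulHom (a : A) : A →+ A where
  toFun := bmul a
  map_zero' := bmul_zero a
  map_add' := bmul_add a

theorem bmul_nsmul (n : ℕ) (a b : A) : bmul a (n • b) = n • bmul a b := map_nsmul (bmulHom a) n b

theorem bmul_circ (a b c : A) : bmul (circ a b) c = bmul a (bmul b c) + bmul a c + bmul b c := by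
  have h := circ_assoc a b c
  simp only [bmul_add] at h
  unfold circ
  rw [← sub_eq_zero] at h ⊢
  rw [← h]
  abel

/-- The elements of `A` annihilated by `n`. -/
def torsion (A : Type*) [LeftBrace A] (n : ℕ) : AddSubgroup A :=
  (nsmulAddMonoidHom n : A →+ A).ker

theorem mem_torsion {n : ℕ} {a : A} : a ∈ torsion A n ↔ n • a = 0 := Iff.rfl

theorem bmul_mem_torsion {n : ℕ} (a : A) {b : A} (hb : b ∈ torsion A n) :
    bmul a b ∈ torsion A n := by
  rw [mem_torsion] at hb ⊢
  rw [← bmul_nsmul, hb, bmul_zero]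

theorem circ_inv_mem_torsion {n : ℕ} {a b : A} (ha : a ∈ torsion A n)
    (h : bmul b a + b + a = 0) : b ∈ torsion A n := by
  have hb : b = -(bmul b a + a) := by
    rw [eq_neg_iff_add_eq_zero, ← h]
    abel
  rw [hb]
  exact neg_mem (add_mem (bmul_mem_torsion b ha) ha)

/-- The `n`-torsion elements form a subbrace. -/
@[reducible] def torsionBrace (A : Type*) [LeftBrace A] (n : ℕ) : LeftBrace (torsion A n) :=
  { (inferInstance : AddCommGroup (torsion A n)) with
    bmul := fun a b => ⟨bmul a.1 b.1, bmul_mem_torsion a.1 b.2⟩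
    bmul_add := fun a b c => Subtype.ext (bmul_add a.1 b.1 c.1)
    circ_assoc := fun a b c => Subtype.ext (circ_assoc a.1 b.1 c.1)
    zero_circ := fun a => Subtype.ext (zero_circ a.1)
    circ_zero := fun a => Subtype.ext (circ_zero a.1)
    exists_circ_inv := fun a => by
      obtain ⟨b, hb, hb'⟩ := exists_circ_inv a.1
      exact ⟨⟨b, circ_inv_mem_torsion a.2 hb'⟩, Subtype.ext hb, Subtype.ext hb'⟩ }

/-- The `n`-torsion elements form a subgroup of the adjoint group. -/
noncomputable def torsionCirc (A : Type*) [LeftBrace A] (n : ℕ) :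
    letI := adjointGroup A
    Subgroup A :=
  letI := adjointGroup A
  { carrier := torsion A n
    one_mem' := zero_mem (torsion A n)
    mul_mem' := fun {a _} ha hb => add_mem (add_mem (bmul_mem_torsion a hb) ha) hb
    inv_mem' := fun {a} ha =>
      circ_inv_mem_torsion ha (Classical.choose_spec (exists_circ_inv a)).2 }

theorem prime_dvd_of_dvd_card_torsion [Finite A] {n p : ℕ} (hp : p.Prime)
    (h : p ∣ Nat.card (torsion A n)) : p ∣ n := by
  have : Fact p.Prime := ⟨hp⟩
  obtain ⟨x, hx⟩ := exists_prime_addOrderOf_dvd_card' p h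
  rw [← hx]
  exact addOrderOf_dvd_of_nsmul_eq_zero (Subtype.ext x.2)

theorem coprime_card_torsion [Finite A] {m n : ℕ} (h : m.Coprime n) :
    (Nat.card (torsion A m)).Coprime (Nat.card (torsion A n)) :=
  Nat.Coprime.symm <| Nat.coprime_of_dvd fun _ hp hn hm =>
    hp.ne_one <| Nat.dvd_one.mp <| h ▸ Nat.dvd_gcd (prime_dvd_of_dvd_card_torsion hp hm)
      (prime_dvd_of_dvd_card_torsion hp hn)

theorem card_torsion_dvd [Finite A] {q r : ℕ} (h : q.Coprime r) (hqr : Nat.card A = q * r) :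
    Nat.card (torsion A q) ∣ q := by
  refine Nat.Coprime.dvd_of_dvd_mul_right (k := Nat.card (torsion A q)) (n := r) ?_
    (hqr ▸ AddSubgroup.card_addSubgroup_dvd_card _)
  exact Nat.Coprime.symm <| Nat.coprime_of_dvd fun _ hp hr hq =>
    hp.ne_one <| Nat.dvd_one.mp <| h ▸ Nat.dvd_gcd (prime_dvd_of_dvd_card_torsion hp hq) hr

theorem bmul_eq_zero_of_coprime_torsion [Finite A] (hnil : AdjointNilpotent A) {m n : ℕ}
    (h : m.Coprime n) {a b : A} (ha : a ∈ torsion A m) (hb : b ∈ torsion A n) :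
    bmul a b = 0 := by
  have hcomm : circ a b = circ b a := by
    let := adjointGroup A
    refine (Group.IsNilpotent.commute_of_coprime_orderOf hnil (x := a) (y := b) ?_).eq
    exact ((coprime_card_torsion h).coprime_dvd_left
      (Subgroup.orderOf_dvd_natCard (torsionCirc A m) ha)).coprime_dvd_right
      (Subgroup.orderOf_dvd_natCard (torsionCirc A n) hb)
  have hab : bmul a b = bmul b a := by
    unfold circ at hcomm
    rw [add_assoc, add_assoc, add_comm b a] at hcomm
    exact add_right_cancel hcomm
  have h1 := bmul_mem_torsion a hb
  have h2 := hab ▸ bmul_mem_torsion b ha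
  rw [mem_torsion, ← addOrderOf_dvd_iff_nsmul_eq_zero] at h1 h2
  rw [← AddMonoid.addOrderOf_eq_one_iff]
  exact Nat.dvd_one.mp (h ▸ Nat.dvd_gcd h2 h1)

theorem nsmul_eq_nsmul_of_modEq_card {m n : ℕ} (h : m ≡ n [MOD Nat.card A]) (a : A) :
    m • a = n • a :=
  nsmul_eq_nsmul_iff_modEq.mpr (h.of_dvd (addOrderOf_dvd_natCard a))

theorem nsmul_mem_torsion {q r e : ℕ} (hqr : Nat.card A = q * r) (hr : r ∣ e) (a : A) :
    e • a ∈ torsion A q := by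
  rw [mem_torsion, ← mul_nsmul', ← zero_nsmul a]
  refine nsmul_eq_nsmul_of_modEq_card ?_ a
  exact Nat.modEq_zero_iff_dvd.mpr (hqr ▸ mul_dvd_mul_left q hr)

theorem bmul_nsmul_nsmul [Finite A] (hnil : AdjointNilpotent A) {q r e : ℕ}
    (h : q.Coprime r) (hqr : Nat.card A = q * r) (hq : e ≡ 1 [MOD q]) (hr : r ∣ e) (a b : A) :
    bmul (e • a) (e • b) = e • bmul a b := by
  have hx := nsmul_mem_torsion hqr hr a
  have hx' := nsmul_mem_torsion hqr hr b
  have hy : a - e • a ∈ torsion A r := by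
    rw [mem_torsion, nsmul_sub, sub_eq_zero, ← mul_nsmul']
    refine nsmul_eq_nsmul_of_modEq_card ?_ a
    rw [hqr, mul_comm q]
    simpa using (hq.mul_left' r).symm
  have ha : circ (a - e • a) (e • a) = a := by
    unfold circ
    rw [bmul_eq_zero_of_coprime_torsion hnil h.symm hy hx, zero_add, sub_add_cancel]
  have hc := bmul_circ (a - e • a) (e • a) (e • b)
  rw [ha, bmul_nsmul, bmul_eq_zero_of_coprime_torsion hnil h.symm hy (bmul_mem_torsion _ hx'),
    bmul_eq_zero_of_coprime_torsion hnil h.symm hy hx', zero_add, zero_add] at hc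
  exact hc.symm

theorem exists_torsion_projections [Finite A] (hnil : AdjointNilpotent A) {k : ℕ} (q : Fin k → ℕ)
    (hq : Pairwise (Function.onFun Nat.Coprime q)) (hcard : Nat.card A = ∏ i, q i) :
    ∃ f : ∀ i, A →+ torsion A (q i),
      (∀ i a b, (f i (bmul a b) : A) = bmul (f i a : A) (f i b)) ∧
      (∀ x, ∑ i, (f i x : A) = x) ∧
      (∀ i, ∀ x : torsion A (q i), f i x = x) ∧
      ∀ i j, i ≠ j → ∀ x : torsion A (q j), f i x = 0 := by
  classical
  let r i := ∏ j ∈ Finset.univ.erase i, q j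
  have hco i : (q i).Coprime (r i) :=
    Nat.Coprime.prod_right fun j hj => hq (Finset.ne_of_mem_erase hj).symm
  have hqr i : Nat.card A = q i * r i := by
    rw [hcard, Finset.mul_prod_erase _ _ (Finset.mem_univ i)]
  choose e he1 he0 using fun i =>
    (⟨_, (Nat.chineseRemainder (hco i) 1 0).2⟩ : ∃ e, e ≡ 1 [MOD q i] ∧ e ≡ 0 [MOD r i])
  have hre i : r i ∣ e i := Nat.modEq_zero_iff_dvd.mp (he0 i)
  have hqe i j (hij : i ≠ j) : q j ∣ e i :=
    (Finset.dvd_prod_of_mem q (Finset.mem_erase.mpr ⟨hij.symm, Finset.mem_univ j⟩)).trans (hre i)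
  have hsum : ∑ i, e i ≡ 1 [MOD Nat.card A] := by
    rw [hcard, Nat.modEq_iff_dvd, Nat.cast_prod]
    refine Finset.prod_dvd_of_coprime (fun i _ j _ hij => (hq hij).isCoprime) fun j _ => ?_
    rw [← Nat.modEq_iff_dvd, ← Finset.add_sum_erase _ _ (Finset.mem_univ j)]
    refine (he1 j).add (Nat.modEq_zero_iff_dvd.mpr (Finset.dvd_sum fun i hi => ?_))
    exact hqe i j (Finset.ne_of_mem_erase hi)
  refine ⟨fun i => (nsmulAddMonoidHom (e i)).codRestrict _ (nsmul_mem_torsion (hqr i) (hre i)),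
    fun i a b => (bmul_nsmul_nsmul hnil (hco i) (hqr i) (he1 i) (hre i) a b).symm,
    fun x => ?_, fun i x => Subtype.ext ?_, fun i j hij x => Subtype.ext ?_⟩
  · change ∑ i, e i • x = x
    rw [← Finset.sum_smul, nsmul_eq_nsmul_of_modEq_card hsum, one_nsmul]
  · change e i • (x : A) = x
    conv_rhs => rw [← one_nsmul (x : A)]
    exact nsmul_eq_nsmul_iff_modEq.mpr
      ((he1 i).of_dvd (addOrderOf_dvd_of_nsmul_eq_zero x.2))
  · exact addOrderOf_dvd_iff_nsmul_eq_zero.mp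
      ((addOrderOf_dvd_of_nsmul_eq_zero x.2).trans (hqe i j hij))

/-- The ascending chain of subgroups, starting from zero, each consisting of the elements
that `A` multiplies into the previous one. -/
def annChain (A : Type*) [LeftBrace A] : ℕ → AddSubgroup A
  | 0 => ⊥
  | n + 1 => ⨅ a : A, (annChain A n).comap (bmulHom a)

theorem mem_annChain_succ {n : ℕ} {x : A} :
    x ∈ annChain A (n + 1) ↔ ∀ a, bmul a x ∈ annChain A n := by
  simp only [annChain, AddSubgroup.mem_iInf, AddSubgroup.mem_comap]
  rfl

theorem bmul_mem_annChain_pred {n : ℕ} (a : A) {x : A} (hx : x ∈ annChain A n) :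
    bmul a x ∈ annChain A (n - 1) := by
  cases n with
  | zero =>
    rw [annChain, AddSubgroup.mem_bot] at hx
    rw [hx, bmul_zero]
    exact zero_mem _
  | succ n => exact mem_annChain_succ.mp hx a

theorem annChain_le_succ (n : ℕ) : annChain A n ≤ annChain A (n + 1) := by
  induction n with
  | zero => simp [annChain]
  | succ n ih =>
    exact fun x hx => mem_annChain_succ.mpr fun a => ih (mem_annChain_succ.mp hx a)

/-- The adjoint group acts on `A ⧸ Z` by `a • b = a·b + b` when `Z` is closed under left
multiplication by `A`. -/
@[reducible] noncomputable def quotientAction (Z : AddSubgroup A)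
    (hZ : ∀ a, ∀ x ∈ Z, bmul a x ∈ Z) :
    letI := adjointGroup A
    MulAction A (A ⧸ Z) :=
  letI := adjointGroup A
  { smul := fun a => QuotientAddGroup.map Z Z (bmulHom a + AddMonoidHom.id A)
      fun x hx => add_mem (hZ a x hx) hx
    one_smul := fun b => by
      obtain ⟨x, rfl⟩ := QuotientAddGroup.mk_surjective b
      refine congrArg (QuotientAddGroup.mk (s := Z)) ?_
      change bmul 0 x + x = x
      rw [zero_bmul, zero_add]
    mul_smul := fun a b c => by
      obtain ⟨x, rfl⟩ := QuotientAddGroup.mk_surjective c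
      refine congrArg (QuotientAddGroup.mk (s := Z)) ?_
      change bmul (circ a b) x + x = bmul a (bmul b x + x) + (bmul b x + x)
      rw [bmul_circ, bmul_add]
      abel }

theorem annChain_lt_succ [Finite A] {p m : ℕ} (hp : p.Prime) (hA : Nat.card A ∣ p ^ m) {n : ℕ}
    (hn : annChain A n ≠ ⊤) : annChain A n < annChain A (n + 1) := by
  have : Fact p.Prime := ⟨hp⟩
  have hle := annChain_le_succ (A := A) n
  have hZ (a x : A) (hx : x ∈ annChain A n) : bmul a x ∈ annChain A n :=
    mem_annChain_succ.mp (hle hx) a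
  have hdvd : p ∣ Nat.card (A ⧸ annChain A n) := by
    obtain ⟨i, -, hi⟩ := (Nat.dvd_prime_pow hp).mp
      (((annChain A n).index_dvd_card).trans hA)
    have hi0 : i ≠ 0 := by
      rintro rfl
      exact hn (AddSubgroup.index_eq_one.mp (by simpa using hi))
    change p ∣ (annChain A n).index
    exact hi ▸ dvd_pow_self p hi0
  obtain ⟨b, hb, hb0⟩ : ∃ b : A ⧸ annChain A n,
      (∀ a x : A, (x : A ⧸ annChain A n) = b → ((bmul a x + x : A) : A ⧸ annChain A n) = b) ∧
        0 ≠ b := by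
    let := adjointGroup A
    let := quotientAction (annChain A n) hZ
    have hG : IsPGroup p A := IsPGroup.of_card_dvd_pow hA
    obtain ⟨b, hb, hb0⟩ := hG.exists_fixed_point_of_prime_dvd_card_of_fixed_point
      (A ⧸ annChain A n) hdvd (a := 0) fun a => map_zero (QuotientAddGroup.map _ _ _ _)
    refine ⟨b, ?_, hb0⟩
    rintro a x rfl
    exact hb a
  obtain ⟨x, rfl⟩ := QuotientAddGroup.mk_surjective b
  refine lt_of_le_of_ne hle fun heq => hb0 ?_
  refine ((QuotientAddGroup.eq_zero_iff x).mpr ?_).symm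
  rw [heq, mem_annChain_succ]
  intro a
  rw [← QuotientAddGroup.eq_zero_iff]
  simpa using hb a x rfl

theorem annChain_eq_top [Finite A] {p m : ℕ} (hp : p.Prime) (hA : Nat.card A ∣ p ^ m) :
    annChain A m = ⊤ := by
  have key (n : ℕ) : annChain A n = ⊤ ∨ p ^ n ∣ Nat.card (annChain A n) := by
    induction n with
    | zero => simp
    | succ n ih =>
      by_cases hn : annChain A n = ⊤
      · exact Or.inl (top_le_iff.mp (hn ▸ annChain_le_succ n))
      have hlt := annChain_lt_succ hp hA hn
      have hcard : Nat.card (annChain A n) < Nat.card (annChain A (n + 1)) :=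
        Set.ncard_lt_ncard (SetLike.coe_ssubset_coe.mpr hlt)
      obtain ⟨i, -, hi⟩ := (Nat.dvd_prime_pow hp).mp
        (((annChain A n).card_addSubgroup_dvd_card).trans hA)
      obtain ⟨j, -, hj⟩ := (Nat.dvd_prime_pow hp).mp
        (((annChain A (n + 1)).card_addSubgroup_dvd_card).trans hA)
      have hni := ih.resolve_left hn
      rw [hi, hj, Nat.pow_lt_pow_iff_right hp.one_lt] at hcard
      rw [hi, Nat.pow_dvd_pow_iff_le_right hp.one_lt] at hni
      exact Or.inr (hj ▸ pow_dvd_pow p (by omega))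
  refine (key m).elim id fun h => AddSubgroup.eq_top_of_card_eq _ ?_
  exact Nat.dvd_antisymm (AddSubgroup.card_addSubgroup_dvd_card _) (hA.trans h)

theorem pow_subset_annChain {m : ℕ} (h : annChain A m = ⊤) (n : ℕ) :
    pow A (n + 1) ⊆ annChain A (m - n) := by
  induction n with
  | zero => simp [h]
  | succ n ih =>
    change setMulSub Set.univ (pow A (n + 1)) ≤ (annChain A (m - (n + 1))).toAddSubmonoid
    refine AddSubmonoid.closure_le.mpr ?_
    rintro _ ⟨a, -, x, hx, rfl⟩
    exact bmul_mem_annChain_pred a (ih hx)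

theorem eq_zero_of_mem_pow [Finite A] {p m n : ℕ} (hp : p.Prime) (hA : Nat.card A ∣ p ^ m)
    (hmn : m ≤ n) {x : A} (hx : x ∈ pow A (n + 1)) : x = 0 := by
  have h := pow_subset_annChain (annChain_eq_top hp hA) n hx
  rwa [Nat.sub_eq_zero_of_le hmn] at h

theorem zero_mem_pow (n : ℕ) : (0 : A) ∈ pow A n := by
  match n with
  | 0 | 1 => exact Set.mem_univ _
  | n + 2 => exact zero_mem (setMulSub Set.univ (pow A (n + 1)))

theorem map_mem_pow {B : Type*} [LeftBrace B] (f : A →+ B)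
    (hf : ∀ a b, f (bmul a b) = bmul (f a) (f b)) (n : ℕ) {x : A} (hx : x ∈ pow A (n + 1)) :
    f x ∈ pow B (n + 1) := by
  induction n generalizing x with
  | zero => exact Set.mem_univ _
  | succ n ih =>
    suffices h : setMulSub Set.univ (pow A (n + 1)) ≤
        (setMulSub Set.univ (pow B (n + 1))).comap f from h hx
    refine AddSubmonoid.closure_le.mpr ?_
    rintro _ ⟨a, -, y, hy, rfl⟩
    exact AddSubmonoid.subset_closure ⟨f a, trivial, f y, ih hy, hf a y⟩

theorem pairwise_coprime_primePow {k : ℕ} {p : Fin k → ℕ} (α : Fin k → ℕ) (hp : ∀ i, (p i).Prime)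
    (hpp : Function.Injective p) :
    Pairwise (Function.onFun Nat.Coprime fun i => p i ^ α i) := fun i j hij =>
  Nat.Coprime.pow _ _ ((Nat.coprime_primes (hp i) (hp j)).mpr (hpp.ne hij))

theorem card_torsion_dvd_of_card_eq_prod [Finite A] {k : ℕ} {q : Fin k → ℕ}
    (hq : Pairwise (Function.onFun Nat.Coprime q)) (hcard : Nat.card A = ∏ i, q i) (i : Fin k) :
    Nat.card (torsion A (q i)) ∣ q i := by
  classical
  refine card_torsion_dvd (r := ∏ j ∈ Finset.univ.erase i, q j)
    (Nat.Coprime.prod_right fun j hj => hq (Finset.ne_of_mem_erase hj).symm) ?_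
  rw [hcard, Finset.mul_prod_erase _ _ (Finset.mem_univ i)]

theorem isPrimePowerDirectSum_of_card {A : Type} [LeftBrace A] [Finite A]
    (hnil : AdjointNilpotent A) {k : ℕ} {p α : Fin k → ℕ} (hp : ∀ i, (p i).Prime)
    (hpp : Function.Injective p) (hcard : Nat.card A = ∏ i, p i ^ α i) :
    IsPrimePowerDirectSum A := by
  have hq := pairwise_coprime_primePow α hp hpp
  obtain ⟨f, hmul, hsum, hself, hzero⟩ := exists_torsion_projections hnil _ hq hcard
  refine ⟨k, fun i => torsion A (p i ^ α i), fun i => torsionBrace A _, fun i => ?_, ⟨?_⟩⟩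
  · obtain ⟨m, -, hm⟩ := (Nat.dvd_prime_pow (hp i)).mp (card_torsion_dvd_of_card_eq_prod hq hcard i)
    exact ⟨p i, m, hp i, hm⟩
  · refine @BraceIso.mk _ _ _ (piBrace _ fun i => torsionBrace A _)
      { toFun := fun x i => f i x
        invFun := fun g => ∑ i, (g i : A)
        left_inv := hsum
        right_inv := fun g => funext fun i => ?_
        map_add' := fun x y => funext fun i => map_add (f i) x y }
      fun a b => funext fun i => Subtype.ext (hmul i a b)
    change f i (∑ j, (g j : A)) = g i
    rw [map_sum, Finset.sum_eq_single i (fun j _ hji => hzero i j hji.symm (g j)) (by simp)]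
    exact hself i (g i)

/-- Let `A` be a finite left brace whose adjoint group `A°` is
nilpotent.  Then `A` is the direct sum of left braces whose cardinalities are powers
of primes; moreover if `A` has cardinality `p₁^{α₁}⋯p_k^{α_k}` with `pᵢ` pairwise
distinct primes and `αᵢ > 0`, then `Aⁿ = 0` where `n = max_i (αᵢ + 1)`. -/
theorem finite_leftBrace_of_adjoint_nilpotent
    (A : Type) [LeftBrace A] [Finite A] (hnil : AdjointNilpotent A) :
    IsPrimePowerDirectSum A ∧
    ∀ (k : ℕ) (p α : Fin k → ℕ), (∀ i, (p i).Prime) → (∀ i j, i ≠ j → p i ≠ p j) →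
      (∀ i, 0 < α i) → Nat.card A = ∏ i, p i ^ α i →
      pow A (Finset.univ.sup (fun i => α i + 1)) = {0} := by
  constructor
  · let φ := (Nat.card A).primeFactors.equivFin
    refine isPrimePowerDirectSum_of_card hnil (p := fun i => φ.symm i)
      (α := fun i => (Nat.card A).factorization (φ.symm i))
      (fun i => Nat.prime_of_mem_primeFactors (φ.symm i).2)
      (Subtype.val_injective.comp φ.symm.injective) ?_
    rw [φ.symm.prod_comp fun l => (l : ℕ) ^ (Nat.card A).factorization l,
      Finset.prod_coe_sort _ fun l => l ^ (Nat.card A).factorization l]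
    exact (Nat.prod_factorization_pow_eq_self Nat.card_pos.ne').symm
  · intro k p α hp hpp _ hcard
    have hq := pairwise_coprime_primePow α hp fun i j hij => not_imp_comm.mp (hpp i j) (· hij)
    obtain ⟨f, hmul, hsum, -⟩ := exists_torsion_projections hnil _ hq hcard
    refine Set.eq_singleton_iff_unique_mem.mpr ⟨zero_mem_pow _, fun x hx => ?_⟩
    rw [← hsum x]
    refine Finset.sum_eq_zero fun i _ => ?_
    have hle := Finset.le_sup (f := fun i => α i + 1) (Finset.mem_univ i)
    obtain ⟨n, hn⟩ := Nat.exists_eq_add_of_le' (Nat.le_of_add_left_le hle)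
    rw [hn] at hle hx
    let := torsionBrace A (p i ^ α i)
    rw [eq_zero_of_mem_pow (hp i) (card_torsion_dvd_of_card_eq_prod hq hcard i)
      (Nat.le_of_add_le_add_right hle)
      (map_mem_pow (f i) (fun a b => Subtype.ext (hmul i a b)) n hx)]
    rfl

end LeftBrace

end Paper
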